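/- arXiv:1710.08236 — 2 statements merged into one kernel-verified Lean document; each statement's English description precedes it below -/
import Mathlib

section
/- Let G be a finite simple graph. Every maximum matching in G is acyclic if and only if every connected component of G is a tree or an odd cycle. -/
open SimpleGraph

/-- A matching `M` in `G` is a *maximum matching* if no matching of `G` has more edges. -/
def IsMaximumMatching {V : Type*} (G : SimpleGraph V) (M : G.Subgraph) : Prop :=
  M.IsMatching ∧ ∀ M' : G.Subgraph, M'.IsMatching → M'.edgeSet.ncard ≤ M.edgeSet.ncard

/-- A matching `M` in `G` is *acyclic* if the subgraph `G(M)` of `G` induced by the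
vertices covered by `M` is a forest. -/
def IsAcyclicMatching {V : Type*} (G : SimpleGraph V) (M : G.Subgraph) : Prop :=
  M.IsMatching ∧ (G.induce M.verts).IsAcyclic

namespace SimpleGraph

variable {V : Type*} {G : SimpleGraph V}

lemma Reachable.mem_of_forall_adj {s : Set V} (hs : ∀ v ∈ s, ∀ w, G.Adj v w → w ∈ s) {u v : V}
    (h : G.Reachable u v) (hu : u ∈ s) : v ∈ s := by
  obtain ⟨p⟩ := h
  induction p with
  | nil => exact hu
  | cons hadj _ ih => exact ih (hs _ hu _ hadj)

lemma Walk.IsCycle.induce {s : Set V} {u : V} {p : G.Walk u u} (hp : p.IsCycle)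
    (hs : ∀ x ∈ p.support, x ∈ s) : (p.induce s hs).IsCycle :=
  .of_map (f := (Embedding.induce s).toHom) (by rwa [map_induce])

lemma Walk.mem_support_tail_iff {u x : V} {p : G.Walk u u} (hp : ¬ p.Nil) :
    x ∈ p.tail.support ↔ x ∈ p.support := by
  rw [support_tail_of_not_nil p hp, mem_support_iff]
  exact ⟨Or.inr, fun h ↦ h.elim (· ▸ p.end_mem_tail_support hp) id⟩

lemma Walk.mem_connectedComponentMk_supp {u v x : V} {p : G.Walk u v} (hx : x ∈ p.support) :
    x ∈ (G.connectedComponentMk u).supp := by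
  classical
  exact (ConnectedComponent.mem_supp_iff _ _).2
    (ConnectedComponent.eq.2 ⟨(p.takeUntil x hx).reverse⟩)

/-- Every cycle in a cycle graph visits all vertices. -/
lemma Walk.IsCycle.mem_support_of_cycleGraph {n : ℕ} (hn : 3 ≤ n) {u : Fin n}
    {p : (cycleGraph n).Walk u u} (hp : p.IsCycle) (v : Fin n) : v ∈ p.support := by
  obtain ⟨m, rfl⟩ : ∃ m, n = m + 3 := ⟨n - 3, by omega⟩
  refine (cycleGraph_preconnected u v).mem_of_forall_adj (s := {v | v ∈ p.support})
    (fun v hv w hvw ↦ ?_) p.start_mem_support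
  have hdeg : ((cycleGraph (m + 3)).neighborSet v).ncard = 2 := by
    rw [Set.ncard_eq_toFinset_card']
    exact cycleGraph_degree_three_le
  have heq : p.toSubgraph.neighborSet v = (cycleGraph (m + 3)).neighborSet v :=
    Set.eq_of_subset_of_ncard_le (p.toSubgraph.neighborSet_subset v)
      (by rw [hdeg, hp.ncard_neighborSet_toSubgraph_eq_two hv])
  have hw : w ∈ p.toSubgraph.neighborSet v := heq ▸ hvw
  exact p.mem_verts_toSubgraph.1 (p.toSubgraph.edge_vert (Subgraph.Adj.symm hw))

namespace Subgraph

variable {M M' : G.Subgraph}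

lemma IsMatching.sup_subgraphOfAdj (hM : M.IsMatching) {v w : V} (h : G.Adj v w)
    (hv : v ∉ M.verts) (hw : w ∉ M.verts) : (M ⊔ G.subgraphOfAdj h).IsMatching := by
  refine hM.sup (.subgraphOfAdj h) (Set.disjoint_left.2 fun x hx hx' ↦ ?_)
  have := M.support_subset_verts hx
  rw [support_subgraphOfAdj] at hx'
  rcases hx' with rfl | rfl <;> contradiction

lemma IsMatching.deleteVerts (hM : M.IsMatching) {v w : V} (h : M.Adj v w) :
    (M.deleteVerts {v, w}).IsMatching := by
  rintro x ⟨hx, hx'⟩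
  obtain ⟨y, hxy, hy⟩ := hM hx
  have hy' : y ∉ ({v, w} : Set V) := by
    rintro (rfl | rfl)
    · exact hx' (Or.inr (hM.eq_of_adj_left hxy.symm h))
    · exact hx' (Or.inl (hM.eq_of_adj_left hxy.symm h.symm))
  exact ⟨y, deleteVerts_adj.2 ⟨hx, hx', M.edge_vert hxy.symm, hy', hxy⟩,
    fun z hz ↦ hy z (deleteVerts_adj.1 hz).2.2.2.2⟩

lemma IsMatching.edgeSet_deleteVerts (hM : M.IsMatching) {v w : V} (h : M.Adj v w) :
    (M.deleteVerts {v, w}).edgeSet = M.edgeSet \ {s(v, w)} := by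
  ext e
  induction e using Sym2.ind with | _ x y
  simp only [Subgraph.mem_edgeSet, deleteVerts_adj, Set.mem_sdiff, Set.mem_singleton_iff, Sym2.eq_iff,
    Set.mem_insert_iff]
  constructor
  · grind
  · rintro ⟨hxy, hne⟩
    refine ⟨M.edge_vert hxy, ?_, M.edge_vert hxy.symm, ?_, hxy⟩
    · rintro (rfl | rfl)
      · exact hne (Or.inl ⟨rfl, hM.eq_of_adj_left hxy h⟩)
      · exact hne (Or.inr ⟨rfl, hM.eq_of_adj_left hxy h.symm⟩)
    · rintro (rfl | rfl)
      · exact hne (Or.inr ⟨hM.eq_of_adj_left hxy.symm h, rfl⟩)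
      · exact hne (Or.inl ⟨hM.eq_of_adj_left hxy.symm h.symm, rfl⟩)

lemma edgeSet_sup_subgraphOfAdj {v w : V} (h : G.Adj v w) :
    (M ⊔ G.subgraphOfAdj h).edgeSet = insert s(v, w) M.edgeSet := by
  rw [edgeSet_sup, edgeSet_subgraphOfAdj, Set.union_singleton]

end Subgraph

/-- The vertices covered by a matching are also covered by some maximum matching. -/
lemma Subgraph.IsMatching.exists_isMaximumMatching_verts_subset [Finite V] {N : G.Subgraph}
    (hN : N.IsMatching) : ∃ M : G.Subgraph, IsMaximumMatching G M ∧ N.verts ⊆ M.verts := by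
  have hex : {M : G.Subgraph | IsMaximumMatching G M}.Nonempty := by
    obtain ⟨M, hM, hmax⟩ := Set.exists_max_image {M : G.Subgraph | M.IsMatching}
      (fun M ↦ M.edgeSet.ncard) (Set.toFinite _) ⟨N, hN⟩
    exact ⟨M, hM, hmax⟩
  obtain ⟨M, ⟨hM, hmax⟩, hinter⟩ := Set.exists_max_image _
    (fun M : G.Subgraph ↦ (M.edgeSet ∩ N.edgeSet).ncard) (Set.toFinite _) hex
  refine ⟨M, ⟨hM, hmax⟩, fun v hv ↦ ?_⟩
  by_contra hvM
  obtain ⟨w, hvw, -⟩ := hN hv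
  have hnot : s(v, w) ∉ M.edgeSet := fun h ↦ hvM (M.edge_vert h)
  by_cases hw : w ∈ M.verts
  · obtain ⟨x, hwx, -⟩ := hM hw
    have hmatch := (hM.deleteVerts hwx).sup_subgraphOfAdj hvw.adj_sub (fun h ↦ hvM h.1)
      (fun h ↦ h.2 (Or.inl rfl))
    have hedge : (M.deleteVerts {w, x} ⊔ G.subgraphOfAdj hvw.adj_sub).edgeSet =
        insert s(v, w) (M.edgeSet \ {s(w, x)}) := by
      rw [edgeSet_sup_subgraphOfAdj, hM.edgeSet_deleteVerts hwx]
    have hcard : (insert s(v, w) (M.edgeSet \ {s(w, x)})).ncard = M.edgeSet.ncard := by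
      rw [Set.ncard_insert_of_notMem (fun h ↦ hnot h.1) (Set.toFinite _),
        Set.ncard_sdiff_singleton_add_one (Subgraph.mem_edgeSet.2 hwx) (Set.toFinite _)]
    have hle := hinter _ ⟨hmatch, fun M' hM' ↦ by rw [hedge, hcard]; exact hmax M' hM'⟩
    have hwxN : s(w, x) ∉ N.edgeSet := fun h ↦
      hvM (hN.eq_of_adj_left hvw.symm h ▸ M.edge_vert hwx.symm)
    have hsub : insert s(v, w) (M.edgeSet ∩ N.edgeSet) ⊆
        insert s(v, w) (M.edgeSet \ {s(w, x)}) ∩ N.edgeSet := by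
      rintro e (rfl | ⟨heM, heN⟩)
      · exact ⟨Or.inl rfl, hvw⟩
      · exact ⟨Or.inr ⟨heM, fun h ↦ hwxN (h ▸ heN)⟩, heN⟩
    have := Set.ncard_le_ncard hsub (Set.toFinite _)
    rw [Set.ncard_insert_of_notMem (fun h ↦ hnot h.1) (Set.toFinite _)] at this
    simp only [hedge] at hle
    omega
  · have := hmax _ (hM.sup_subgraphOfAdj hvw.adj_sub hvM hw)
    rw [edgeSet_sup_subgraphOfAdj, Set.ncard_insert_of_notMem hnot (Set.toFinite _)] at this
    omega

/-- A path with an odd number of edges has a perfect matching. -/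
lemma Walk.IsPath.exists_isMatching_verts_eq {u v : V} :
    ∀ {p : G.Walk u v}, p.IsPath → Odd p.length →
      ∃ M : G.Subgraph, M.IsMatching ∧ M.verts = {x | x ∈ p.support}
  | .nil, _, hodd => by simp at hodd
  | .cons h .nil, _, _ => ⟨G.subgraphOfAdj h, .subgraphOfAdj h, by ext; simp⟩
  | .cons h (.cons h' p), hp, hodd => by
    obtain ⟨M, hM, hverts⟩ := hp.of_cons.of_cons.exists_isMatching_verts_eq
      (by simpa [Nat.odd_add_one, Nat.not_odd_iff_even, Nat.not_even_iff_odd] using hodd)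
    simp only [Walk.cons_isPath_iff, Walk.support_cons, List.mem_cons, not_or] at hp
    refine ⟨M ⊔ G.subgraphOfAdj h, hM.sup_subgraphOfAdj h ?_ ?_, ?_⟩
    · simpa [hverts] using hp.2.2
    · simpa [hverts] using hp.1.2
    · ext x
      simp [hverts]

/-- No matching covers a cycle if all maximum matchings are acyclic. -/
lemma Walk.IsCycle.exists_mem_support_notMem_verts [Finite V]
    (hG : ∀ M : G.Subgraph, IsMaximumMatching G M → IsAcyclicMatching G M)
    {u : V} {p : G.Walk u u} (hp : p.IsCycle) {N : G.Subgraph} (hN : N.IsMatching) :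
    ∃ x ∈ p.support, x ∉ N.verts := by
  by_contra! hcov
  obtain ⟨M, hM, hsub⟩ := hN.exists_isMaximumMatching_verts_subset
  exact (hG M hM).2 _ (hp.induce fun x hx ↦ hsub (hcov x hx))

lemma Walk.IsCycle.odd_length [Finite V]
    (hG : ∀ M : G.Subgraph, IsMaximumMatching G M → IsAcyclicMatching G M)
    {u : V} {p : G.Walk u u} (hp : p.IsCycle) : Odd p.length := by
  by_contra heven
  have hlen := p.length_tail_add_one hp.not_nil
  obtain ⟨M, hM, hverts⟩ := hp.isPath_tail.exists_isMatching_verts_eq (by grind)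
  obtain ⟨x, hx, hxM⟩ := hp.exists_mem_support_notMem_verts hG hM
  rw [hverts] at hxM
  exact hxM ((mem_support_tail_iff hp.not_nil).2 hx)

lemma Walk.IsCycle.mem_support_of_adj [Finite V]
    (hG : ∀ M : G.Subgraph, IsMaximumMatching G M → IsAcyclicMatching G M)
    {u : V} {p : G.Walk u u} (hp : p.IsCycle) {v w : V} (hv : v ∈ p.support) (hvw : G.Adj v w) :
    w ∈ p.support := by
  classical
  wlog huv : u = v generalizing u p
  · simpa [mem_support_rotate_iff] using
      this (hp.rotate hv) (by simp) rfl
  subst huv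
  by_contra hw
  have hlen := p.length_tail_add_one hp.not_nil
  have hodd := hp.odd_length hG
  have hpath : (p.tail.concat hvw).IsPath :=
    hp.isPath_tail.concat (fun h ↦ hw ((mem_support_tail_iff hp.not_nil).1 h)) hvw
  obtain ⟨M, hM, hverts⟩ := hpath.exists_isMatching_verts_eq (by rwa [length_concat, hlen])
  obtain ⟨x, hx, hxM⟩ := hp.exists_mem_support_notMem_verts hG hM
  rw [hverts] at hxM
  exact hxM (p.tail.support_subset_support_concat hvw ((mem_support_tail_iff hp.not_nil).2 hx))

/-- Cycles are chordless if all maximum matchings are acyclic. -/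
lemma Walk.IsCycle.mem_edges_of_adj [Finite V]
    (hG : ∀ M : G.Subgraph, IsMaximumMatching G M → IsAcyclicMatching G M)
    {u : V} {p : G.Walk u u} (hp : p.IsCycle) {v w : V} (hv : v ∈ p.support) (hvw : G.Adj v w) :
    s(v, w) ∈ p.edges := by
  classical
  wlog huv : u = v generalizing u p
  · exact (p.rotate_edges v hv).mem_iff.1 <|
      this (hp.rotate hv) (by simp) rfl
  subst huv
  by_contra hedge
  have hw := hp.mem_support_of_adj hG hv hvw
  have hspec := p.take_spec hw
  have htake : (cons hvw.symm (p.takeUntil w hw)).IsCycle :=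
    (cons_isCycle_iff _ _).2 ⟨hp.isPath_takeUntil hw, fun h ↦
      hedge (Sym2.eq_swap ▸ p.edges_takeUntil_subset_edges hw h)⟩
  have hdrop : (cons hvw (p.dropUntil w hw)).IsCycle :=
    (cons_isCycle_iff _ _).2 ⟨(hspec.symm ▸ hp).isPath_of_append_right (not_nil_of_ne hvw.ne), fun h ↦
      hedge (p.edges_dropUntil_subset_edges hw h)⟩
  have h1 := htake.odd_length hG
  have h2 := hdrop.odd_length hG
  have h3 := hp.odd_length hG
  have hlen := congrArg Walk.length hspec
  simp only [length_append, length_cons] at h1 h2 hlen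
  grind

lemma ConnectedComponent.isTree_or_nonempty_iso_cycleGraph [Finite V]
    (hG : ∀ M : G.Subgraph, IsMaximumMatching G M → IsAcyclicMatching G M)
    (c : G.ConnectedComponent) : (G.induce c.supp).IsTree ∨
      ∃ n : ℕ, Odd n ∧ 3 ≤ n ∧ Nonempty ((G.induce c.supp) ≃g cycleGraph n) := by
  by_cases hac : (G.induce c.supp).IsAcyclic
  · exact Or.inl ⟨c.maximal_connected_induce_supp.prop, hac⟩
  right
  rw [isAcyclic_iff_free_cycleGraph] at hac
  push Not at hac
  obtain ⟨n, hn, hfree⟩ := hac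
  obtain ⟨f⟩ := hfree
  obtain ⟨m, rfl⟩ : ∃ m, n = m + 3 := ⟨n - 3, by omega⟩
  let g : cycleGraph (m + 3) →g G := (Embedding.induce c.supp).toHom.comp f.toHom
  have hinj : Function.Injective g := Subtype.val_injective.comp f.injective
  have hp : ((cycleGraph.cycle m).map g).IsCycle := cycleGraph.isCycle_cycle.map hinj
  have hsupp (i) : g i ∈ ((cycleGraph.cycle m).map g).support := by
    rw [Walk.support_map]
    exact List.mem_map_of_mem (cycleGraph.isCycle_cycle.mem_support_of_cycleGraph hn i)
  have hsurj : Function.Surjective f := by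
    rintro ⟨v, hv⟩
    have hreach : G.Reachable (g 0) v := c.reachable_of_mem_supp (f 0).2 hv
    have hmem := hreach.mem_of_forall_adj (s := {v | v ∈ ((cycleGraph.cycle m).map g).support})
      (fun _ hv _ hvw ↦ hp.mem_support_of_adj hG hv hvw) (hsupp 0)
    obtain ⟨i, -, hi⟩ := List.mem_map.1 (Walk.support_map g _ ▸ hmem)
    exact ⟨i, Subtype.ext hi⟩
  refine ⟨m + 3, by simpa using hp.odd_length hG, hn,
    ⟨(RelIso.mk (Equiv.ofBijective f ⟨f.injective, hsurj⟩) fun {i j} ↦ ⟨fun h ↦ ?_, fun h ↦ ?_⟩).symm⟩⟩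
  · have hmem := hp.mem_edges_of_adj hG (hsupp i) (w := g j) h
    rw [Walk.edges_map] at hmem
    obtain ⟨e, he, heq⟩ := List.mem_map.1 hmem
    have : e = s(i, j) := Sym2.map.injective hinj heq
    exact (cycleGraph.cycle m).adj_of_mem_edges (this ▸ he)
  · exact f.toHom.map_adj h

lemma Subgraph.IsMatching.even_ncard_supp [Finite V] {M : G.Subgraph} (hM : M.IsMatching)
    (c : G.ConnectedComponent) (hc : c.supp ⊆ M.verts) : Even c.supp.ncard := by
  classical
  have := Fintype.ofFinite V
  have h := (hM.induce_connectedComponent c).even_card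
  rwa [← Set.ncard_eq_toFinset_card', Subgraph.induce_verts, Set.inter_eq_right.2 hc] at h

lemma Subgraph.IsMatching.isAcyclic_induce_verts [Finite V]
    (hG : ∀ c : G.ConnectedComponent, (G.induce c.supp).IsTree ∨
      ∃ n : ℕ, Odd n ∧ 3 ≤ n ∧ Nonempty ((G.induce c.supp) ≃g cycleGraph n))
    {M : G.Subgraph} (hM : M.IsMatching) : (G.induce M.verts).IsAcyclic := by
  intro u p hp
  have hq : (p.map (Embedding.induce M.verts).toHom).IsCycle := hp.map Subtype.val_injective
  have hqM : ∀ x ∈ (p.map (Embedding.induce M.verts).toHom).support, x ∈ M.verts := by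
    intro x hx
    obtain ⟨y, -, rfl⟩ := List.mem_map.1 (Walk.support_map _ p ▸ hx)
    exact y.2
  generalize p.map (Embedding.induce M.verts).toHom = q at hq hqM
  have hr := hq.induce fun x hx ↦ Walk.mem_connectedComponentMk_supp hx
  rcases hG (G.connectedComponentMk _) with htree | ⟨n, hodd, hn, ⟨e⟩⟩
  · exact htree.isAcyclic _ hr
  · refine Nat.not_even_iff_odd.2 hodd ?_
    have hcard := Nat.card_congr e.toEquiv
    rw [Nat.card_coe_set_eq, Nat.card_fin] at hcard
    rw [← hcard]
    refine hM.even_ncard_supp _ fun x hx ↦ hqM x ?_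
    have hmem := (hr.map (f := e.toHom) e.injective).mem_support_of_cycleGraph hn (e ⟨x, hx⟩)
    rw [Walk.support_map] at hmem
    obtain ⟨y, hy, hye⟩ := List.mem_map.1 hmem
    obtain rfl : y = ⟨x, hx⟩ := e.injective hye
    rw [Walk.support_induce] at hy
    exact (List.mem_attachWith ..).1 hy

end SimpleGraph

/-- For a finite simple graph `G`, every maximum matching in `G` is
acyclic if and only if every connected component of `G` is a tree or an odd cycle. -/
theorem every_maximumMatching_acyclic_iff {V : Type*} [Fintype V] (G : SimpleGraph V) :
    (∀ M : G.Subgraph, IsMaximumMatching G M → IsAcyclicMatching G M) ↔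
      (∀ c : G.ConnectedComponent,
        (G.induce c.supp).IsTree ∨
          ∃ n : ℕ, Odd n ∧ 3 ≤ n ∧ Nonempty ((G.induce c.supp) ≃g cycleGraph n)) :=
  ⟨fun hG c ↦ c.isTree_or_nonempty_iso_cycleGraph hG,
    fun hG _ hM ↦ ⟨hM.1, hM.1.isAcyclic_induce_verts hG⟩⟩
end

section
/- If G is a finite simple graph in which every maximum matching is acyclic, and C is a cycle in G, then the vertex set of C induces a connected component of G and C has odd length. -/
open SimpleGraph

section MaximumMatching

variable {V : Type*} {G : SimpleGraph V}

/-- `M` is a maximum matching of `G` which, among all maximum matchings, contains as many edges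
from `E` as possible. -/
def IsMaximumMatchingFavoring (G : SimpleGraph V) (E : Set (Sym2 V)) (M : G.Subgraph) : Prop :=
  IsMaximumMatching G M ∧ ∀ M' : G.Subgraph, IsMaximumMatching G M' →
    (M'.edgeSet ∩ E).ncard ≤ (M.edgeSet ∩ E).ncard

lemma exists_isMaximumMatchingFavoring [Finite V] (G : SimpleGraph V) (E : Set (Sym2 V)) :
    ∃ M, IsMaximumMatchingFavoring G E M := by
  obtain ⟨M₀, h₀, hmax₀⟩ := Set.exists_max_image {M : G.Subgraph | M.IsMatching}
    (fun M => M.edgeSet.ncard) (Set.toFinite _) ⟨⊥, fun _ h => h.elim⟩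
  obtain ⟨M, h, hmax⟩ := Set.exists_max_image {M : G.Subgraph | IsMaximumMatching G M}
    (fun M => (M.edgeSet ∩ E).ncard) (Set.toFinite _) ⟨M₀, h₀, hmax₀⟩
  exact ⟨M, h, hmax⟩

lemma SimpleGraph.Subgraph.IsMatching.sup_subgraphOfAdj_s12 {M : G.Subgraph} (hM : M.IsMatching)
    {x y : V} (hxy : G.Adj x y) (hx : x ∉ M.verts) (hy : y ∉ M.verts) :
    (M ⊔ G.subgraphOfAdj hxy).IsMatching := by
  refine hM.sup (.subgraphOfAdj hxy) ?_
  rw [hM.support_eq_verts, support_subgraphOfAdj, Set.disjoint_right]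
  rintro z (rfl | rfl) <;> assumption

lemma SimpleGraph.Subgraph.IsMatching.deleteVerts_pair {M : G.Subgraph} (hM : M.IsMatching)
    {y p : V} (hyp : M.Adj y p) : (M.deleteVerts {y, p}).IsMatching := by
  rintro u ⟨hu, hu'⟩
  obtain ⟨w, hw, huniq⟩ := hM hu
  refine ⟨w, ?_, fun z hz => huniq z ?_⟩
  · refine Subgraph.deleteVerts_adj.mpr ⟨hu, hu', hw.snd_mem, ?_, hw⟩
    rintro (rfl | rfl)
    · exact hu' (.inr (hM.eq_of_adj_right hw hyp.symm))
    · exact hu' (.inl (hM.eq_of_adj_right hw hyp))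
  · exact (Subgraph.deleteVerts_adj.mp hz).2.2.2.2

lemma SimpleGraph.Subgraph.IsMatching.edgeSet_deleteVerts_pair {M : G.Subgraph}
    (hM : M.IsMatching) {y p : V} (hyp : M.Adj y p) :
    (M.deleteVerts {y, p}).edgeSet = M.edgeSet \ {s(y, p)} := by
  ext e
  induction e with | _ a b
  simp only [Subgraph.mem_edgeSet, Subgraph.deleteVerts_adj, Set.mem_sdiff, Set.mem_singleton_iff,
    Set.mem_insert_iff, Sym2.eq_iff]
  constructor
  · rintro ⟨-, ha, -, hb, hab⟩
    exact ⟨hab, by tauto⟩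
  · rintro ⟨hab, hne⟩
    refine ⟨hab.fst_mem, ?_, hab.snd_mem, ?_, hab⟩
    · rintro (rfl | rfl)
      · exact hne (.inl ⟨rfl, hM.eq_of_adj_left hab hyp⟩)
      · exact hne (.inr ⟨rfl, hM.eq_of_adj_left hab hyp.symm⟩)
    · rintro (rfl | rfl)
      · exact hne (.inr ⟨hM.eq_of_adj_left hab.symm hyp, rfl⟩)
      · exact hne (.inl ⟨hM.eq_of_adj_left hab.symm hyp.symm, rfl⟩)

/-- A maximum matching missing `x` covers every neighbour `y` of `x`, and the edge covering `y`
can be exchanged for `xy`. -/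
lemma IsMaximumMatching.exists_exchange [Finite V] {M : G.Subgraph} (hM : IsMaximumMatching G M)
    {x y : V} (hxy : G.Adj x y) (hx : x ∉ M.verts) :
    ∃ p, M.Adj y p ∧ ∃ M', IsMaximumMatching G M' ∧
      M'.verts = insert x (M.verts \ {p}) ∧
      M'.edgeSet = insert s(x, y) (M.edgeSet \ {s(y, p)}) := by
  have hx_edge (z : V) : s(x, z) ∉ M.edgeSet := fun h => hx (M.edge_vert h)
  have hy : y ∈ M.verts := by
    by_contra hy
    have h := hM.2 _ (hM.1.sup_subgraphOfAdj_s12 hxy hx hy)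
    rw [Subgraph.edgeSet_sup, edgeSet_subgraphOfAdj, Set.union_singleton,
      Set.ncard_insert_of_notMem (hx_edge y)] at h
    omega
  obtain ⟨p, hyp, -⟩ := hM.1 hy
  have hmatch : (M.deleteVerts {y, p} ⊔ G.subgraphOfAdj hxy).IsMatching :=
    (hM.1.deleteVerts_pair hyp).sup_subgraphOfAdj_s12 hxy (fun h => hx h.1) (fun h => h.2 (.inl rfl))
  have hedge : (M.deleteVerts {y, p} ⊔ G.subgraphOfAdj hxy).edgeSet =
      insert s(x, y) (M.edgeSet \ {s(y, p)}) := by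
    rw [Subgraph.edgeSet_sup, edgeSet_subgraphOfAdj, Set.union_singleton,
      hM.1.edgeSet_deleteVerts_pair hyp]
  refine ⟨p, hyp, _, ⟨hmatch, fun M'' h => ?_⟩, ?_, hedge⟩
  · rw [hedge, Set.ncard_exchange (hx_edge y) hyp]
    exact hM.2 M'' h
  · ext z
    have hyp' := hyp.ne
    simp only [Subgraph.verts_sup, Subgraph.deleteVerts_verts, subgraphOfAdj_verts, Set.mem_union,
      Set.mem_sdiff, Set.mem_insert_iff, Set.mem_singleton_iff]
    grind

lemma IsMaximumMatchingFavoring.exists_exchange [Finite V] {E : Set (Sym2 V)} {M : G.Subgraph}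
    (hM : IsMaximumMatchingFavoring G E M) {x y : V} (hxy : G.Adj x y) (hE : s(x, y) ∈ E)
    (hx : x ∉ M.verts) :
    ∃ p, M.Adj y p ∧ s(y, p) ∈ E ∧ ∃ M', IsMaximumMatchingFavoring G E M' ∧
      p ∉ M'.verts ∧ M'.edgeSet = insert s(x, y) (M.edgeSet \ {s(y, p)}) := by
  obtain ⟨p, hyp, M', hM', hverts, hedge⟩ := hM.1.exists_exchange hxy hx
  have hx_edge : s(x, y) ∉ M.edgeSet ∩ E := fun h => hx (M.edge_vert h.1)
  have hinter : M'.edgeSet ∩ E = insert s(x, y) ((M.edgeSet ∩ E) \ {s(y, p)}) := by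
    rw [hedge, Set.insert_inter_of_mem hE, Set.sdiff_inter_right_comm]
  have hypE : s(y, p) ∈ E := by
    by_contra hypE
    have h := hM.2 M' hM'
    rw [hinter, Set.sdiff_singleton_eq_self fun h => hypE h.2,
      Set.ncard_insert_of_notMem hx_edge] at h
    omega
  refine ⟨p, hyp, hypE, M', ⟨hM', fun M'' h => ?_⟩, ?_, hedge⟩
  · rw [hinter, Set.ncard_exchange hx_edge ⟨hyp, hypE⟩]
    exact hM.2 M'' h
  · rw [hverts]
    rintro (rfl | h)
    · exact hx hyp.snd_mem
    · exact h.2 rfl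

/-- The sequence of vertices met when running around a closed walk forever. -/
def SimpleGraph.Walk.cyclicVert {v : V} (C : G.Walk v v) (i : ℕ) : V :=
  C.getVert (i % C.length)

lemma SimpleGraph.Walk.IsCycle.cyclicVert_eq_iff {v : V} {C : G.Walk v v} (hC : C.IsCycle)
    {a b : ℕ} : C.cyclicVert a = C.cyclicVert b ↔ a ≡ b [MOD C.length] := by
  have hpos : 0 < C.length := by have := hC.three_le_length; omega
  have ha := Nat.mod_lt a hpos
  have hb := Nat.mod_lt b hpos
  refine ⟨fun h => hC.getVert_injOn' ?_ ?_ h, fun h => congrArg C.getVert h⟩ <;>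
    simp only [Set.mem_ofPred_eq] <;> omega

lemma SimpleGraph.Walk.IsCycle.adj_cyclicVert {v : V} {C : G.Walk v v} (hC : C.IsCycle) (i : ℕ) :
    G.Adj (C.cyclicVert i) (C.cyclicVert (i + 1)) := by
  have hpos : 0 < C.length := by have := hC.three_le_length; omega
  have hi := Nat.mod_lt i hpos
  have hadj := C.adj_getVert_succ hi
  have hsucc : C.cyclicVert (i + 1) = C.getVert (i % C.length + 1) := by
    rw [Walk.cyclicVert, ← Nat.mod_add_mod]
    rcases (show i % C.length + 1 ≤ C.length from hi).lt_or_eq with h | h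
    · rw [Nat.mod_eq_of_lt h]
    · simp [h]
  rwa [hsucc]

lemma SimpleGraph.Walk.mem_support_iff_exists_cyclicVert {v : V} {C : G.Walk v v} {x : V} :
    x ∈ C.support ↔ ∃ i, C.cyclicVert i = x := by
  constructor
  · intro h
    obtain ⟨i, rfl, hi⟩ := Walk.mem_support_iff_exists_getVert.mp h
    rcases hi.lt_or_eq with hi | rfl
    · exact ⟨i, by rw [Walk.cyclicVert, Nat.mod_eq_of_lt hi]⟩
    · exact ⟨0, by simp [Walk.cyclicVert]⟩
  · rintro ⟨i, rfl⟩
    exact C.getVert_mem_support _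

/-- The edges of a closed walk, as consecutive pairs of `cyclicVert`. -/
def SimpleGraph.Walk.cyclicEdges {v : V} (C : G.Walk v v) : Set (Sym2 V) :=
  Set.range fun i => s(C.cyclicVert i, C.cyclicVert (i + 1))

lemma SimpleGraph.Walk.IsCycle.eq_of_mem_cyclicEdges {v : V} {C : G.Walk v v} (hC : C.IsCycle)
    {i : ℕ} {p : V} (h : s(C.cyclicVert (i + 1), p) ∈ C.cyclicEdges) :
    p = C.cyclicVert i ∨ p = C.cyclicVert (i + 2) := by
  obtain ⟨j, hj⟩ := h
  rcases Sym2.eq_iff.mp hj with ⟨h₁, h₂⟩ | ⟨h₁, h₂⟩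
  · right
    rw [← h₂, hC.cyclicVert_eq_iff]
    exact (hC.cyclicVert_eq_iff.mp h₁).add_right 1
  · left
    rw [← h₁, hC.cyclicVert_eq_iff]
    exact (hC.cyclicVert_eq_iff.mp h₂).add_right_cancel' 1

lemma IsMaximumMatchingFavoring.exists_shift [Finite V] {v : V} {C : G.Walk v v} (hC : C.IsCycle)
    {M : G.Subgraph} (hM : IsMaximumMatchingFavoring G C.cyclicEdges M) {i : ℕ}
    (hi : C.cyclicVert i ∉ M.verts) :
    M.Adj (C.cyclicVert (i + 1)) (C.cyclicVert (i + 2)) ∧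
      ∃ M', IsMaximumMatchingFavoring G C.cyclicEdges M' ∧ C.cyclicVert (i + 2) ∉ M'.verts ∧
        M'.edgeSet ⊆ insert s(C.cyclicVert i, C.cyclicVert (i + 1)) M.edgeSet := by
  obtain ⟨p, hadj, hpE, M', hM', hp, hedge⟩ :=
    hM.exists_exchange (hC.adj_cyclicVert i) ⟨i, rfl⟩ hi
  obtain rfl | rfl := hC.eq_of_mem_cyclicEdges hpE
  · exact (hi hadj.snd_mem).elim
  · exact ⟨hadj, M', hM', hp, hedge ▸ Set.insert_subset_insert Set.sdiff_subset⟩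

lemma IsMaximumMatchingFavoring.adj_cyclicVert [Finite V] {v : V} {C : G.Walk v v}
    (hC : C.IsCycle) (k : ℕ) (hk : 2 * k + 2 ≤ C.length) {M : G.Subgraph}
    (hM : IsMaximumMatchingFavoring G C.cyclicEdges M) {i : ℕ} (hi : C.cyclicVert i ∉ M.verts) :
    M.Adj (C.cyclicVert (i + 2 * k + 1)) (C.cyclicVert (i + 2 * k + 2)) := by
  induction k generalizing M i with
  | zero => exact (hM.exists_shift hC hi).1
  | succ k ih =>
    obtain ⟨-, M', hM', hi', hedge⟩ := hM.exists_shift hC hi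
    have h := ih (by omega) hM' hi'
    rw [show i + 2 + 2 * k = i + 2 * (k + 1) by ring] at h
    refine (hedge (Subgraph.mem_edgeSet.mpr h)).resolve_left fun heq => ?_
    have hne (a d : ℕ) (hd : 0 < d) (hdn : d < C.length) :
        C.cyclicVert (a + d) ≠ C.cyclicVert a := fun h => by
      have h := (hC.cyclicVert_eq_iff.mp h).symm
      rw [Nat.modEq_iff_dvd' (by omega), Nat.add_sub_cancel_left] at h
      exact absurd (Nat.le_of_dvd hd h) (by omega)
    rcases Sym2.eq_iff.mp heq with ⟨h₁, -⟩ | ⟨h₁, -⟩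
    · exact hne i (2 * (k + 1) + 1) (by omega) (by omega) h₁
    · exact hne (i + 1) (2 * (k + 1)) (by omega) (by omega)
        ((congrArg C.cyclicVert (by omega)).trans h₁)

end MaximumMatching

/-- If `G` is a finite simple graph in which every maximum matching is
acyclic and `C` is a cycle in `G`, then the vertex set of `C` is (the vertex set of) a
connected component of `G`, and `C` has odd length. -/
theorem cycle_is_odd_component {V : Type*} [Fintype V] (G : SimpleGraph V)
    (hall : ∀ M : G.Subgraph, IsMaximumMatching G M → IsAcyclicMatching G M)
    {v : V} (C : G.Walk v v) (hC : C.IsCycle) :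
    (∃ c : G.ConnectedComponent, {x | x ∈ C.support} = c.supp) ∧ Odd C.length := by
  set c := C.cyclicVert with hcdef
  have hn := hC.three_le_length
  have hcover (M : G.Subgraph) (hM : IsMaximumMatching G M) : ∃ i, c i ∉ M.verts := by
    by_contra! h
    have hsub : ∀ x ∈ C.support, x ∈ M.verts := fun x hx => by
      obtain ⟨i, rfl⟩ := Walk.mem_support_iff_exists_cyclicVert.mp hx
      exact h i
    refine (hall M hM).2 (C.induce M.verts hsub) (.of_map (f := (Embedding.induce _).toHom) ?_)
    rwa [Walk.map_induce]
  have hperiod (i : ℕ) : c (i + C.length) = c i :=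
    hC.cyclicVert_eq_iff.mpr (by simp [Nat.ModEq])
  obtain ⟨M₀, hM₀⟩ := exists_isMaximumMatchingFavoring G C.cyclicEdges
  obtain ⟨i₀, hi₀⟩ := hcover M₀ hM₀.1
  have hodd : Odd C.length := by
    by_contra heven
    obtain ⟨m, hm⟩ := Nat.not_odd_iff_even.mp heven
    have h := (hM₀.adj_cyclicVert hC (m - 1) (by omega) hi₀).snd_mem
    rw [show i₀ + 2 * (m - 1) + 2 = i₀ + C.length by omega] at h
    exact hi₀ (hperiod i₀ ▸ h)
  obtain ⟨m, hm⟩ := hodd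
  have hmissable (j : ℕ) :
      ∃ M, IsMaximumMatchingFavoring G C.cyclicEdges M ∧ c j ∉ M.verts := by
    have hshift (i k : ℕ)
        (h : ∃ M, IsMaximumMatchingFavoring G C.cyclicEdges M ∧ c i ∉ M.verts) :
        ∃ M, IsMaximumMatchingFavoring G C.cyclicEdges M ∧ c (i + 2 * k) ∉ M.verts := by
      induction k with
      | zero => exact h
      | succ k ih =>
        obtain ⟨M, hM, hi⟩ := ih
        obtain ⟨-, M', hM', hi', -⟩ := hM.exists_shift hC hi
        exact ⟨M', hM', hi'⟩
    have hsucc (k : ℕ) :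
        ∃ M, IsMaximumMatchingFavoring G C.cyclicEdges M ∧ c (i₀ + k) ∉ M.verts := by
      induction k with
      | zero => exact ⟨M₀, hM₀, hi₀⟩
      | succ k ih =>
        -- the length is `2 * m + 1`, so shifting `m + 1` times by two is a shift by one
        have h := hshift _ (m + 1) ih
        rwa [show i₀ + k + 2 * (m + 1) = i₀ + (k + 1) + C.length by omega, hperiod] at h
    have hmul (k : ℕ) : c (j + C.length * k) = c j :=
      hC.cyclicVert_eq_iff.mpr (by simp [Nat.ModEq])
    have hle : i₀ ≤ j + C.length * i₀ := by nlinarith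
    obtain ⟨k, hk⟩ := Nat.exists_eq_add_of_le hle
    have h := hsucc k
    rwa [← hk, hmul] at h
  have hpartner (M : G.Subgraph) (hM : IsMaximumMatchingFavoring G C.cyclicEdges M) (i j : ℕ)
      (hi : c i ∉ M.verts) : c j = c i ∨ ∃ l, M.Adj (c j) (c l) := by
    obtain ⟨d, hd, hjd⟩ : ∃ d < C.length, c j = c (i + d) := by
      refine ⟨(j + (C.length - 1) * i) % C.length, Nat.mod_lt _ (by omega), ?_⟩
      rw [hcdef, hC.cyclicVert_eq_iff]
      refine Nat.ModEq.symm (((Nat.mod_modEq _ _).add_left i).trans ?_)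
      have : i + (j + (C.length - 1) * i) = j + C.length * i := by
        obtain ⟨n, hn'⟩ : ∃ n, C.length = n + 1 := ⟨C.length - 1, by omega⟩
        rw [hn', Nat.add_sub_cancel]
        ring
      rw [this]
      simp [Nat.ModEq]
    rcases d.even_or_odd' with ⟨k, rfl | rfl⟩
    · rcases k with _ | k
      · exact .inl hjd
      · exact .inr ⟨i + 2 * k + 1, by rw [hjd]; exact (hM.adj_cyclicVert hC k (by omega) hi).symm⟩
    · exact .inr ⟨i + 2 * k + 2, by rw [hjd]; exact hM.adj_cyclicVert hC k (by omega) hi⟩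
  have hclosed (x w : V) (hx : x ∈ C.support) (hxw : G.Adj x w) : w ∈ C.support := by
    by_contra hw
    obtain ⟨i, rfl⟩ := Walk.mem_support_iff_exists_cyclicVert.mp hx
    obtain ⟨M, hM, hi⟩ := hmissable i
    obtain ⟨p, hwp, M', hM', hverts, -⟩ := hM.1.exists_exchange hxw hi
    obtain ⟨j, hj⟩ := hcover M' hM'
    rw [hverts, Set.mem_insert_iff, not_or] at hj
    obtain ⟨l, hl⟩ := (hpartner M hM i j hi).resolve_left hj.1
    have hjp : c j = p := by
      by_contra hne
      exact hj.2 ⟨hl.fst_mem, hne⟩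
    have hlw := hM.1.1.eq_of_adj_left (hjp ▸ hl) hwp.symm
    exact hw (Walk.mem_support_iff_exists_cyclicVert.mpr ⟨l, hlw⟩)
  refine ⟨⟨G.connectedComponentMk v, ?_⟩, m, hm⟩
  ext x
  rw [ConnectedComponent.mem_supp_iff, ConnectedComponent.eq, Set.mem_ofPred_eq]
  constructor
  · classical exact fun hx => (C.takeUntil x hx).reachable.symm
  · rintro ⟨p⟩
    have hmem {y z : V} (q : G.Walk y z) (hy : y ∈ C.support) : z ∈ C.support := by
      induction q with
      | nil => exact hy
      | cons h _ ih => exact ih (hclosed _ _ hy h)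
    exact hmem p.reverse C.start_mem_support
end
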